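/- Kernel alphabet statistics for random strings: let s be a random string of length n ≥ 2 with each character drawn i.i.d. uniformly from an alphabet of size σ ≥ 2, and set q = (2−σ)/σ. The peeling kernel K(s) contains exactly one distinct symbol if and only if r(s) is odd, and exactly two distinct symbols otherwise; moreover Pr(|alphabet(K(s))| = 1) = (1 + q^{n−1})/2. -/

import Mathlib

/-- The alphabet `α` extended with two sentinel symbols `@` and `$`. -/
abbrev Symb (α : Type*) := α ⊕ Bool

/-- The sentinel `@`. -/
def atSym {α : Type*} : Symb α := Sum.inr false

/-- The sentinel `$`. -/
def dollarSym {α : Type*} : Symb α := Sum.inr true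

instance {α : Type*} : Inhabited (Symb α) := ⟨atSym⟩

/-- A bilateral token: a symbol string together with a split position. -/
structure Tok (β : Type*) where
  sym : List β
  split : ℕ
  deriving DecidableEq

instance {β : Type*} : Inhabited (Tok β) := ⟨⟨[], 0⟩⟩

/-- Fuel-based bilateral peeling.  On a nonempty span: if the span is a single
maximal run, emit the terminal token `(span, 0)`; otherwise remove the maximal
leading run and the maximal trailing run, emit the token whose symbol string is
the leading run concatenated with the trailing run (split = leading-run length,
or split 0 and stop if nothing remains in the middle), and recurse on the
middle.  Any fuel `≥` the span length suffices. -/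
def peelF {β : Type*} [DecidableEq β] : ℕ → List β → List (Tok β)
  | 0, _ => []
  | _ + 1, [] => []
  | fuel + 1, a :: t =>
    let w := a :: t
    let front := w.takeWhile (fun x => decide (x = a))
    let rest := w.dropWhile (fun x => decide (x = a))
    if rest.isEmpty then [⟨w, 0⟩]
    else
      let z := w.getLastD a
      let back := (w.reverse.takeWhile (fun x => decide (x = z))).reverse
      let mid := rest.take (rest.length - back.length)
      if mid.isEmpty then [⟨front ++ back, 0⟩]
      else ⟨front ++ back, front.length⟩ :: peelF fuel mid

/-- The sentinel-wrapped form `ŝ = @ · s · $`. -/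
def wrap {α : Type*} (s : List α) : List (Symb α) :=
  atSym :: s.map Sum.inl ++ [dollarSym]

/-- The Flashback decomposition `F(s)`. -/
def flashback {α : Type*} [DecidableEq α] (s : List α) : List (Tok (Symb α)) :=
  peelF (wrap s).length (wrap s)

/-- Inside-out nesting of a token sequence: the innermost symbol string is
returned verbatim, and each earlier token contributes `front ‖ inner ‖ back`. -/
def nestTok {β : Type*} : List (Tok β) → List β
  | [] => []
  | [τ] => τ.sym
  | τ :: rest => τ.sym.take τ.split ++ nestTok rest ++ τ.sym.drop τ.split

/-- The Flashback reconstruction `F⁻¹(T)`: nest the tokens and strip the two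
sentinels. -/
def reconstruct {α : Type*} (T : List (Tok (Symb α))) : List α :=
  (((nestTok T).drop 1).dropLast).filterMap Sum.getLeft?

/-- The number of maximal runs of a string. -/
def runCount {α : Type*} [DecidableEq α] : List α → ℕ
  | [] => 0
  | [_] => 1
  | a :: b :: t => (if a = b then 0 else 1) + runCount (b :: t)

/-- Length of the maximal leading run. -/
def leadRunLen {α : Type*} [DecidableEq α] : List α → ℕ
  | [] => 0
  | a :: t => (t.takeWhile (fun x => decide (x = a))).length + 1

/-- Length of the maximal trailing run. -/
def trailRunLen {α : Type*} [DecidableEq α] (w : List α) : ℕ :=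
  leadRunLen w.reverse

theorem runCount_replicate {α : Type*} [DecidableEq α] (a : α) (k : ℕ) :
    runCount (List.replicate (k + 1) a) = 1 := by
  induction k with
  | zero => simp [runCount]
  | succ k ih =>
    rw [List.replicate_succ] at ih ⊢
    simp only [List.replicate_succ, runCount, if_true, ih]

theorem runCount_cons_of_head_ne {α : Type*} [DecidableEq α] {a : α} {l : List α}
    (hl : l ≠ []) (h : l.head hl ≠ a) : runCount (a :: l) = runCount l + 1 := by
  cases l with
  | nil => exact absurd rfl hl
  | cons b t =>
    have h' : a ≠ b := fun e => h (by simp [e])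
    simp [runCount, h', add_comm]

theorem runCount_replicate_append {α : Type*} [DecidableEq α] {a : α} {l : List α} (k : ℕ)
    (hl : l ≠ []) (h : l.head hl ≠ a) :
    runCount (List.replicate (k + 1) a ++ l) = runCount l + 1 := by
  induction k with
  | zero => simpa using runCount_cons_of_head_ne hl h
  | succ k ih =>
    rw [List.replicate_succ, List.cons_append] at ih ⊢
    simp only [List.replicate_succ, List.cons_append, runCount, if_true, ih, zero_add]

theorem runCount_append_replicate {α : Type*} [DecidableEq α] {z : α} {l : List α} (m : ℕ)
    (hl : l ≠ []) (h : l.getLast hl ≠ z) :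
    runCount (l ++ List.replicate (m + 1) z) = runCount l + 1 := by
  induction l with
  | nil => exact absurd rfl hl
  | cons b t ih =>
    cases t with
    | nil =>
      have hb : b ≠ z := by simpa using h
      rw [List.singleton_append, runCount_cons_of_head_ne (by simp) (by simpa using hb.symm),
        runCount_replicate]
      rfl
    | cons c t =>
      have := ih (by simp) (by simpa using h)
      simp only [List.cons_append] at this ⊢
      simp only [runCount, this, add_assoc]

theorem runCount_map_of_injective {α β : Type*} [DecidableEq α] [DecidableEq β] {f : α → β}
    (hf : Function.Injective f) (l : List α) : runCount (l.map f) = runCount l := by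
  induction l with
  | nil => rfl
  | cons a t ih =>
    cases t with
    | nil => rfl
    | cons b t =>
      simp only [List.map_cons] at ih ⊢
      simp only [runCount, ih, hf.eq_iff]

theorem runCount_wrap {α : Type*} [DecidableEq α] {s : List α} (hs : s ≠ []) :
    runCount (wrap s) = runCount s + 2 := by
  have h1 : s.map (Sum.inl : α → Symb α) ≠ [] := by simpa using hs
  have key := runCount_append_replicate (z := (dollarSym : Symb α)) 0 h1
    (by simp [dollarSym])
  have key2 := runCount_replicate_append (a := (atSym : Symb α)) 0
    (l := s.map Sum.inl ++ [dollarSym]) (by simp) (by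
      rw [List.head_append_of_ne_nil h1]
      simp [atSym])
  simp only [zero_add, List.replicate_one, List.singleton_append] at key key2
  rw [wrap, List.cons_append, key2, key, runCount_map_of_injective Sum.inl_injective]

theorem List.takeWhile_decide_eq_replicate {α : Type*} [DecidableEq α] (a : α) (l : List α) :
    l.takeWhile (fun x => decide (x = a)) =
      List.replicate (l.takeWhile (fun x => decide (x = a))).length a :=
  List.eq_replicate_of_mem fun b hb => by
    have := List.mem_takeWhile_imp hb
    simpa using this

theorem exists_replicate_append_head_ne {α : Type*} [DecidableEq α] (a : α) (t : List α) :
    ∃ k r, a :: t = List.replicate (k + 1) a ++ r ∧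
      (a :: t).takeWhile (fun x => decide (x = a)) = List.replicate (k + 1) a ∧
      (a :: t).dropWhile (fun x => decide (x = a)) = r ∧ ∀ h : r ≠ [], r.head h ≠ a := by
  have e := List.takeWhile_decide_eq_replicate a (a :: t)
  have hlen : ((a :: t).takeWhile (fun x => decide (x = a))).length
      = (t.takeWhile (fun x => decide (x = a))).length + 1 := by simp
  rw [hlen] at e
  refine ⟨_, _, ?_, e, rfl, fun h => ?_⟩
  · rw [← e, List.takeWhile_append_dropWhile]
  · have := List.head_dropWhile_not (fun x => decide (x = a)) h
    simpa using this

/-- The trailing run of a nonempty string, read off its reversal. -/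
theorem exists_append_replicate_getLast_ne {α : Type*} [DecidableEq α] {l : List α}
    (hl : l ≠ []) : ∃ m r, l = r ++ List.replicate (m + 1) (l.getLast hl) ∧
      (∀ h : r ≠ [], r.getLast h ≠ l.getLast hl) := by
  obtain ⟨z, t, hz⟩ := List.exists_cons_of_ne_nil (l := l.reverse) (by simpa using hl)
  have hlz : l = t.reverse ++ [z] := by
    rw [← List.reverse_reverse l, hz, List.reverse_cons]
  have hlast : l.getLast hl = z := by subst hlz; simp
  obtain ⟨m, r, h1, -, -, h2⟩ := exists_replicate_append_head_ne z t
  refine ⟨m, r.reverse, ?_, fun h => ?_⟩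
  · rw [hlast]
    nth_rewrite 1 [← List.reverse_reverse l, hz, h1]
    simp
  · rw [hlast, List.getLast_reverse]
    exact h2 _

theorem takeWhile_decide_eq_replicate_append {α : Type*} [DecidableEq α] {z : α} {l : List α}
    (m : ℕ) (h : ∀ hl : l ≠ [], l.head hl ≠ z) :
    (List.replicate m z ++ l).takeWhile (fun x => decide (x = z)) = List.replicate m z := by
  rw [List.takeWhile_append_of_pos (by simp +contextual [List.mem_replicate])]
  cases l with
  | nil => simp
  | cons b t =>
    have : b ≠ z := by simpa using h
    simp [this]

/-- A nonempty string is a single run, two adjacent runs, or a nonempty middle enclosed by its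
maximal leading and trailing runs. -/
theorem run_trichotomy {α : Type*} [DecidableEq α] {w : List α} (hw : w ≠ []) :
    (∃ k a, w = List.replicate (k + 1) a) ∨
    ∃ k a m z mid, w = List.replicate (k + 1) a ++ (mid ++ List.replicate (m + 1) z) ∧
      (mid = [] → a ≠ z) ∧ (∀ h : mid ≠ [], mid.head h ≠ a ∧ mid.getLast h ≠ z) := by
  obtain ⟨a, t, rfl⟩ := List.exists_cons_of_ne_nil hw
  obtain ⟨k, r, h1, -, -, h2⟩ := exists_replicate_append_head_ne a t
  rw [h1]
  by_cases hr : r = []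
  · exact Or.inl ⟨k, a, by simp [hr]⟩
  obtain ⟨m, mid, h3, h4⟩ := exists_append_replicate_getLast_ne hr
  refine Or.inr ⟨k, a, m, r.getLast hr, mid, by rw [← h3], ?_, fun h => ⟨?_, h4 h⟩⟩
  · rintro rfl e
    apply h2 hr
    rw [e]
    generalize r.getLast hr = z at *
    subst h3
    simp
  · have := h2 hr
    generalize r.getLast hr = z at *
    subst h3
    rwa [List.head_append_of_ne_nil h] at this

theorem peelF_replicate {β : Type*} [DecidableEq β] (f k : ℕ) (a : β) :
    peelF (f + 1) (List.replicate (k + 1) a) = [⟨List.replicate (k + 1) a, 0⟩] := by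
  simp [List.replicate_succ, peelF]

theorem peelF_replicate_append {β : Type*} [DecidableEq β] (f k m : ℕ) {a z : β} {mid : List β}
    (h0 : mid = [] → a ≠ z) (h : ∀ h : mid ≠ [], mid.head h ≠ a ∧ mid.getLast h ≠ z) :
    peelF (f + 1) (List.replicate (k + 1) a ++ (mid ++ List.replicate (m + 1) z)) =
      if mid.isEmpty then [⟨List.replicate (k + 1) a ++ List.replicate (m + 1) z, 0⟩]
      else ⟨List.replicate (k + 1) a ++ List.replicate (m + 1) z, k + 1⟩ :: peelF f mid := by
  set w := List.replicate (k + 1) a ++ (mid ++ List.replicate (m + 1) z) with hw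
  have hr : ∀ hl : mid ++ List.replicate (m + 1) z ≠ [],
      (mid ++ List.replicate (m + 1) z).head hl ≠ a := by
    intro hl
    by_cases hm : mid = []
    · subst hm; simpa using (h0 rfl).symm
    · rw [List.head_append_of_ne_nil hm]; exact (h hm).1
  have front : w.takeWhile (fun x => decide (x = a)) = List.replicate (k + 1) a :=
    takeWhile_decide_eq_replicate_append _ hr
  have rest : w.dropWhile (fun x => decide (x = a)) = mid ++ List.replicate (m + 1) z := by
    have := List.takeWhile_append_dropWhile (p := fun x => decide (x = a)) (l := w)
    rw [front, hw] at this
    exact List.append_cancel_left this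
  have last : w.getLastD a = z := by
    simp [hw, List.getLastD_eq_getLast?, List.getLast?_replicate]
  have back : (w.reverse.takeWhile (fun x => decide (x = z))).reverse
      = List.replicate (m + 1) z := by
    have : w.reverse = List.replicate (m + 1) z ++ (mid.reverse ++ List.replicate (k + 1) a) := by
      simp [hw]
    rw [this, takeWhile_decide_eq_replicate_append, List.reverse_replicate]
    intro hl
    by_cases hm : mid = []
    · subst hm; simpa using h0 rfl
    · rw [List.head_append_of_ne_nil (by simpa using hm), List.head_reverse]; exact (h hm).2
  obtain ⟨t, ht⟩ : ∃ t, w = a :: t := ⟨_, by rw [hw, List.replicate_succ, List.cons_append]⟩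
  rw [ht] at front rest last back ⊢
  simp only [peelF, front, rest, last, back]
  simp

/-- The terminal token of the peeling carries one symbol or two, according to the parity of the
number of runs. -/
theorem card_toFinset_peelF_getLastD {β : Type*} [DecidableEq β] (f : ℕ) {w : List β}
    (hw : w ≠ []) (hf : w.length ≤ f) (d : Tok β) :
    ((peelF f w).getLastD d).sym.toFinset.card = if Odd (runCount w) then 1 else 2 := by
  induction f generalizing w d with
  | zero => exact absurd (List.length_eq_zero_iff.mp (Nat.le_zero.mp hf)) hw
  | succ f ih =>
    obtain ⟨k, a, rfl⟩ | ⟨k, a, m, z, mid, rfl, h0, h⟩ := run_trichotomy hw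
    · simp [peelF_replicate, runCount_replicate, List.toFinset_replicate_of_ne_zero]
    · rw [peelF_replicate_append f k m h0 h]
      by_cases hm : mid = []
      · subst hm
        rw [List.nil_append, runCount_replicate_append k (by simp) (by simpa using (h0 rfl).symm),
          runCount_replicate]
        simp [List.toFinset_append, List.toFinset_replicate_of_ne_zero,
          Nat.odd_iff, Finset.card_pair (h0 rfl)]
      · have hr : runCount (List.replicate (k + 1) a ++ (mid ++ List.replicate (m + 1) z))
            = runCount mid + 2 := by
          rw [runCount_replicate_append k (by simp)
            (by rw [List.head_append_of_ne_nil hm]; exact (h hm).1),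
            runCount_append_replicate m hm (h hm).2]
        have hlen : mid.length ≤ f := by
          simp only [List.length_append, List.length_replicate] at hf
          omega
        rw [hr, if_neg (by simpa using hm), List.getLastD_cons, ih hm hlen]
        simp [Nat.odd_add]

theorem card_toFinset_flashback_kernel {α : Type*} [DecidableEq α] {s : List α} (hs : s ≠ []) :
    ((flashback s).getLastD default).sym.toFinset.card = if Odd (runCount s) then 1 else 2 := by
  rw [flashback, card_toFinset_peelF_getLastD _ (by simp [wrap]) le_rfl, runCount_wrap hs]
  simp [Nat.odd_add]

theorem sum_neg_one_pow_runCount_cons {α : Type*} [DecidableEq α] [Fintype α] (n : ℕ) (a : α) :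
    ∑ t : Fin n → α, (-1 : ℝ) ^ runCount (a :: List.ofFn t) =
      -(2 - (Fintype.card α : ℝ)) ^ n := by
  induction n generalizing a with
  | zero => simp [runCount]
  | succ n ih =>
    rw [← (Fin.consEquiv fun _ : Fin (n + 1) => α).sum_comp, Fintype.sum_prod_type]
    have inner (b : α) : ∑ t : Fin n → α,
        (-1 : ℝ) ^ runCount (a :: List.ofFn (Fin.consEquiv (fun _ : Fin (n + 1) => α) (b, t))) =
        (if a = b then 2 else 0) * -(2 - (Fintype.card α : ℝ)) ^ n
          + (2 - (Fintype.card α : ℝ)) ^ n := by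
      simp only [Fin.consEquiv, Equiv.coe_fn_mk, List.ofFn_cons, runCount, pow_add,
        ← Finset.mul_sum, ih]
      split_ifs <;> ring
    rw [Finset.sum_congr rfl fun b _ => inner b, Finset.sum_add_distrib, ← Finset.sum_mul]
    simp
    ring

theorem sum_neg_one_pow_runCount {α : Type*} [DecidableEq α] [Fintype α] (n : ℕ) :
    ∑ s : Fin (n + 1) → α, (-1 : ℝ) ^ runCount (List.ofFn s) =
      -(Fintype.card α * (2 - (Fintype.card α : ℝ)) ^ n) := by
  rw [← (Fin.consEquiv fun _ : Fin (n + 1) => α).sum_comp, Fintype.sum_prod_type]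
  simp only [Fin.consEquiv, Equiv.coe_fn_mk, List.ofFn_cons, sum_neg_one_pow_runCount_cons]
  simp

theorem card_odd_runCount {α : Type*} [DecidableEq α] [Fintype α] (n : ℕ) :
    (Fintype.card {s : Fin (n + 1) → α // Odd (runCount (List.ofFn s))} : ℝ) =
      ((Fintype.card α : ℝ) ^ (n + 1)
        + Fintype.card α * (2 - (Fintype.card α : ℝ)) ^ n) / 2 := by
  have indicator (s : Fin (n + 1) → α) : (if Odd (runCount (List.ofFn s)) then (1 : ℝ) else 0)
      = (1 - (-1) ^ runCount (List.ofFn s)) / 2 := by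
    split_ifs with h
    · rw [h.neg_one_pow]; norm_num
    · rw [(Nat.not_odd_iff_even.mp h).neg_one_pow]; norm_num
  rw [Fintype.card_subtype, ← Finset.sum_boole, Finset.sum_congr rfl fun s _ => indicator s,
    ← Finset.sum_div, Finset.sum_sub_distrib, sum_neg_one_pow_runCount]
  simp

/-- **Kernel alphabet statistics.**  Let `s` be a uniformly random string of
length `n ≥ 2` over an alphabet of size `σ ≥ 2` and set `q = (2-σ)/σ`.  The
peeling kernel `K(s)` (the symbol string of the terminal token of `F(s)`)
contains exactly one distinct symbol iff `r(s)` is odd and exactly two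
distinct symbols otherwise; moreover
`Pr(|alphabet(K(s))| = 1) = (1 + q^{n-1})/2`. -/
theorem flashback_kernel_alphabet_statistics (n σa : ℕ) (hn : 2 ≤ n) (hσ : 2 ≤ σa) :
    (∀ s : Fin n → Fin σa,
      (((flashback (List.ofFn s)).getLastD default).sym.toFinset.card = 1 ↔
        Odd (runCount (List.ofFn s))) ∧
      (((flashback (List.ofFn s)).getLastD default).sym.toFinset.card = 2 ↔
        ¬ Odd (runCount (List.ofFn s)))) ∧
    (Fintype.card {s : Fin n → Fin σa //
        ((flashback (List.ofFn s)).getLastD default).sym.toFinset.card = 1} : ℝ)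
        / (σa : ℝ) ^ n =
      (1 + ((2 - (σa : ℝ)) / σa) ^ (n - 1)) / 2 := by 
  have hne (s : Fin n → Fin σa) : List.ofFn s ≠ [] := by
    rw [Ne, List.ofFn_eq_nil_iff]; omega
  have kernel (s : Fin n → Fin σa) := card_toFinset_flashback_kernel (hne s)
  have one_iff (s : Fin n → Fin σa) :
      ((flashback (List.ofFn s)).getLastD default).sym.toFinset.card = 1 ↔
        Odd (runCount (List.ofFn s)) := by
    rw [kernel]; split_ifs with h <;> simp [h]
  refine ⟨fun s => ⟨one_iff s, ?_⟩, ?_⟩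
  · rw [kernel]; split_ifs with h <;> simp [h]
  · rw [Fintype.card_congr (Equiv.subtypeEquivRight one_iff)]
    obtain ⟨n, rfl⟩ : ∃ m, n = m + 1 := ⟨n - 1, by omega⟩
    have hσ0 : (σa : ℝ) ≠ 0 := by positivity
    rw [card_odd_runCount, Fintype.card_fin, Nat.add_sub_cancel, div_pow, pow_succ]
    field_simp
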